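/- For every real number a ≥ 1, every zero of φ₀(a,·) away from the points 0, 1/2, 1 is simple: if ρ ∈ ℂ, ρ ∉ {0, 1/2, 1}, and φ₀(a,ρ) = 0, then the derivative in s of φ₀(a,s) at s = ρ is nonzero. -/

import Mathlib

open Complex

/-- The constant term `φ₀(a,s) = Λ(2s) a^s + Λ(2s-1) a^{1-s}` of the completed
nonholomorphic Eisenstein series for the modular group, where `Λ` is the completed
Riemann zeta function. -/
noncomputable def phi0 (a : ℝ) (s : ℂ) : ℂ :=
  completedRiemannZeta (2 * s) * (a : ℂ) ^ s +
    completedRiemannZeta (2 * s - 1) * (a : ℂ) ^ (1 - s)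

open scoped ComplexConjugate

/-- `∑ n ^ (-s) ≤ s / (s - 1)` for real `s > 1`. -/
lemma tsum_one_div_nat_add_one_rpow_le {s : ℝ} (hs : 1 < s) :
    ∑' n : ℕ, 1 / (n + 1 : ℝ) ^ s ≤ s / (s - 1) := by
  have h := ZetaAsymptotics.zeta_limit_aux1 hs
  have h0 : 0 ≤ ZetaAsymptotics.termTSum s :=
    tsum_nonneg fun n ↦ ZetaAsymptotics.term_nonneg _ _
  have h1 : s / (s - 1) = 1 + 1 / (s - 1) := by
    field_simp [show s - 1 ≠ 0 by linarith]
    ring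
  have h2 : 0 ≤ s * ZetaAsymptotics.termTSum s := by positivity
  rw [h1]
  linarith

lemma summable_one_div_nat_add_one_rpow {s : ℝ} (hs : 1 < s) :
    Summable fun n : ℕ ↦ 1 / (n + 1 : ℝ) ^ s := by
  have := (summable_nat_add_iff 1).mpr (Real.summable_one_div_nat_rpow.mpr hs)
  simpa using this

lemma norm_inv_riemannZeta_le {s : ℂ} (hs : 1 < s.re) :
    ‖(riemannZeta s)⁻¹‖ ≤ s.re / (s.re - 1) := by
  have h1 := ArithmeticFunction.LSeries_zeta_mul_Lseries_moebius hs
  rw [ArithmeticFunction.LSeries_zeta_eq_riemannZeta hs] at h1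
  rw [inv_eq_of_mul_eq_one_right h1]
  refine le_trans ?_ (tsum_one_div_nat_add_one_rpow_le hs)
  have hsum := ArithmeticFunction.LSeriesSummable_moebius_iff.mpr hs
  have hreal : Summable fun n : ℕ ↦ 1 / (n : ℝ) ^ s.re := Real.summable_one_div_nat_rpow.mpr hs
  have hle : ∑' n : ℕ, 1 / (n : ℝ) ^ s.re = ∑' n : ℕ, 1 / (n + 1 : ℝ) ^ s.re := by
    rw [hreal.tsum_eq_zero_add]
    simp [Real.zero_rpow (by linarith : s.re ≠ 0)]
  rw [← hle]
  refine tsum_of_norm_bounded hreal.hasSum fun n ↦ ?_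
  rw [LSeries.norm_term_eq]
  split_ifs with hn
  · positivity
  · gcongr
    rw [Complex.norm_intCast]
    exact_mod_cast ArithmeticFunction.abs_moebius_le_one

/-- Comparison term between `(s - 1) * (n + 1) ^ (-s)` and the corresponding integral. -/
noncomputable def zetaTerm (n : ℕ) (s : ℂ) : ℂ :=
  (s - 1) * (n + 1 : ℂ) ^ (-s) + ((n + 2 : ℂ) ^ (1 - s) - (n + 1 : ℂ) ^ (1 - s))

lemma norm_zetaTerm_le (n : ℕ) {s : ℂ} (hs : 0 < s.re) :
    ‖zetaTerm n s‖ ≤ ‖s - 1‖ * ‖s‖ * (1 / (n + 1 : ℝ) ^ (s.re + 1)) := by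
  set N : ℝ := n + 1 with hN
  have hN0 : 0 < N := by positivity
  have hder (r : ℂ) {x : ℝ} (hx : x ∈ Set.Icc N (N + 1)) :
      HasDerivWithinAt (fun y : ℝ ↦ (y : ℂ) ^ r) (r * (x : ℂ) ^ (r - 1)) (Set.Icc N (N + 1)) x := by
    have hx0 : 0 < x := hN0.trans_le hx.1
    by_cases hr : r = 0
    · subst hr
      simpa using hasDerivWithinAt_const x (Set.Icc N (N + 1)) (1 : ℂ)
    exact (hasDerivAt_ofReal_cpow_const hx0.ne' hr).hasDerivWithinAt
  have hpow {x : ℝ} (hx : x ∈ Set.Icc N (N + 1)) :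
      ‖(x : ℂ) ^ (-s) - (N : ℂ) ^ (-s)‖ ≤ ‖s‖ * (1 / N ^ (s.re + 1)) := by
    have hb : ∀ y ∈ Set.Icc N (N + 1),
        ‖-s * (y : ℂ) ^ (-s - 1)‖ ≤ ‖s‖ * (1 / N ^ (s.re + 1)) := fun y hy ↦ by
      have hy0 : 0 < y := hN0.trans_le hy.1
      rw [norm_mul, norm_neg, norm_cpow_eq_rpow_re_of_pos hy0]
      gcongr
      rw [one_div, ← Real.rpow_neg hN0.le]
      have : (-s - 1).re = -(s.re + 1) := by simp; ring
      rw [this]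
      exact Real.rpow_le_rpow_of_nonpos hN0 hy.1 (by linarith)
    have := (convex_Icc N (N + 1)).norm_image_sub_le_of_norm_hasDerivWithin_le
      (fun y hy ↦ hder (-s) hy) hb (Set.left_mem_Icc.mpr (by linarith)) hx
    refine this.trans ?_
    rw [Real.norm_eq_abs, abs_of_nonneg (by linarith [hx.1])]
    exact mul_le_of_le_one_right (by positivity) (by linarith [hx.2])
  have hG : ∀ x ∈ Set.Icc N (N + 1), HasDerivWithinAt
      (fun y : ℝ ↦ (y : ℂ) ^ (1 - s) + (s - 1) * (N : ℂ) ^ (-s) * (y : ℂ))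
      ((1 - s) * ((x : ℂ) ^ (-s) - (N : ℂ) ^ (-s))) (Set.Icc N (N + 1)) x := fun x hx ↦ by
    have h2 : HasDerivWithinAt (fun y : ℝ ↦ (y : ℂ)) 1 (Set.Icc N (N + 1)) x :=
      (hasDerivAt_id x).ofReal_comp.hasDerivWithinAt
    refine ((hder (1 - s) hx).add (h2.const_mul ((s - 1) * (N : ℂ) ^ (-s)))).congr_deriv ?_
    rw [show (1 - s - 1 : ℂ) = -s by ring]
    ring
  have hG' : ∀ x ∈ Set.Icc N (N + 1), ‖(1 - s) * ((x : ℂ) ^ (-s) - (N : ℂ) ^ (-s))‖ ≤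
      ‖s - 1‖ * ‖s‖ * (1 / N ^ (s.re + 1)) := fun x hx ↦ by
    rw [norm_mul, norm_sub_rev, mul_assoc]
    gcongr
    exact hpow hx
  have := (convex_Icc N (N + 1)).norm_image_sub_le_of_norm_hasDerivWithin_le hG hG'
    (Set.left_mem_Icc.mpr (by linarith)) (Set.right_mem_Icc.mpr (by linarith))
  rw [add_sub_cancel_left, norm_one, mul_one] at this
  refine le_of_eq_of_le ?_ this
  rw [zetaTerm, hN]
  push_cast
  rw [show (n : ℂ) + 1 + 1 = n + 2 by ring]
  congr 1
  ring

lemma differentiable_zetaTerm (n : ℕ) : Differentiable ℂ (zetaTerm n) := by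
  have h1 : (n + 1 : ℂ) ≠ 0 := by exact_mod_cast n.succ_ne_zero
  have h2 : (n + 2 : ℂ) ≠ 0 := by exact_mod_cast (n + 1).succ_ne_zero
  unfold zetaTerm
  intro s
  refine DifferentiableAt.add ?_ (DifferentiableAt.sub ?_ ?_)
  · exact (differentiableAt_id.sub_const 1).mul (differentiableAt_id.neg.const_cpow (.inl h1))
  · exact (differentiableAt_id.const_sub 1).const_cpow (.inl h2)
  · exact (differentiableAt_id.const_sub 1).const_cpow (.inl h1)

lemma summable_zetaTerm {s : ℂ} (hs : 0 < s.re) : Summable fun n ↦ zetaTerm n s :=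
  .of_norm_bounded ((summable_one_div_nat_add_one_rpow (by linarith)).mul_left _)
    fun n ↦ norm_zetaTerm_le n hs

lemma tsum_zetaTerm_of_one_lt_re {s : ℂ} (hs : 1 < s.re) :
    ∑' n, zetaTerm n s = riemannZeta₁ s - 1 := by
  have hs1 : s ≠ 1 := by rintro rfl; simp at hs
  have hsum := summable_zetaTerm (s := s) (by linarith)
  have hζ : Summable fun n : ℕ ↦ (n + 1 : ℂ) ^ (-s) := by
    have := (summable_nat_add_iff 1).mpr (Complex.summable_one_div_nat_cpow.mpr hs)
    simpa [cpow_neg] using this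
  have htel : Summable fun n : ℕ ↦ ((n + 2 : ℂ) ^ (1 - s) - (n + 1 : ℂ) ^ (1 - s)) := by
    simpa [zetaTerm] using hsum.sub (hζ.mul_left (s - 1))
  have htel' : ∑' n : ℕ, ((n + 2 : ℂ) ^ (1 - s) - (n + 1 : ℂ) ^ (1 - s)) = -1 := by
    refine tendsto_nhds_unique htel.hasSum.tendsto_sum_nat ?_
    have hpart (N : ℕ) : ∑ n ∈ Finset.range N, ((n + 2 : ℂ) ^ (1 - s) - (n + 1 : ℂ) ^ (1 - s)) =
        (N + 1 : ℂ) ^ (1 - s) - 1 := by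
      have := Finset.sum_range_sub (fun n : ℕ ↦ (n + 1 : ℂ) ^ (1 - s)) N
      simp only [Nat.cast_add, Nat.cast_one, Nat.cast_zero, zero_add, one_cpow] at this
      rw [← this]
      refine Finset.sum_congr rfl fun n _ ↦ ?_
      rw [show (n : ℂ) + 1 + 1 = n + 2 by ring]
    simp_rw [hpart]
    have hlim : Filter.Tendsto (fun N : ℕ ↦ (N + 1 : ℂ) ^ (1 - s)) Filter.atTop (nhds 0) := by
      rw [tendsto_zero_iff_norm_tendsto_zero]
      have h1 : Filter.Tendsto (fun N : ℕ ↦ ((N : ℝ) + 1) ^ (-(s.re - 1))) Filter.atTop (nhds 0) :=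
        (tendsto_rpow_neg_atTop (by linarith)).comp
          (Filter.tendsto_atTop_add_const_right _ 1 tendsto_natCast_atTop_atTop)
      refine h1.congr fun N ↦ ?_
      have := norm_cpow_eq_rpow_re_of_pos (x := (N : ℝ) + 1) (by positivity) (1 - s)
      push_cast at this
      rw [this]
      congr 1
      simp
    simpa using hlim.sub_const 1
  have : ∑' n, zetaTerm n s = (s - 1) * ∑' n : ℕ, (n + 1 : ℂ) ^ (-s) + -1 := by
    rw [← htel', ← tsum_mul_left, ← (hζ.mul_left (s - 1)).tsum_add htel]
    rfl
  rw [this, ← sub_eq_add_neg]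
  congr 1
  have hz := riemannZeta_eq_inv_sub_mul hs1
  rw [zeta_eq_tsum_one_div_nat_add_one_cpow hs] at hz
  simp only [cpow_neg, ← one_div]
  rw [hz]
  field_simp [sub_ne_zero.mpr hs1]

lemma isOpen_re_pos : IsOpen {z : ℂ | 0 < z.re} := isOpen_lt continuous_const continuous_re

lemma isPreconnected_re_pos : IsPreconnected {z : ℂ | 0 < z.re} :=
  (convex_halfSpace_re_gt 0).isPreconnected

lemma tsum_zetaTerm {s : ℂ} (hs : 0 < s.re) : ∑' n, zetaTerm n s = riemannZeta₁ s - 1 := by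
  have hd : DifferentiableOn ℂ (fun s ↦ ∑' n, zetaTerm n s) {z : ℂ | 0 < z.re} := by
    intro s hs
    have hs : 0 < s.re := hs
    set U : Set ℂ := {z | s.re / 2 < z.re} ∩ Metric.ball 0 (‖s‖ + 1) with hU
    have hUo : IsOpen U := (isOpen_lt continuous_const continuous_re).inter Metric.isOpen_ball
    have hsU : s ∈ U := ⟨by show s.re / 2 < s.re; linarith, by simp⟩
    refine (DifferentiableOn.differentiableAt (s := U) ?_ (hUo.mem_nhds hsU)).differentiableWithinAt
    refine differentiableOn_tsum_of_summable_norm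
      (u := fun n : ℕ ↦ (‖s‖ + 2) * (‖s‖ + 1) * (1 / (n + 1 : ℝ) ^ (s.re / 2 + 1)))
      ((summable_one_div_nat_add_one_rpow (by linarith)).mul_left _)
      (fun n ↦ (differentiable_zetaTerm n).differentiableOn) hUo fun n w hw ↦ ?_
    obtain ⟨hw1, hw2⟩ := hw
    have hw1 : s.re / 2 < w.re := hw1
    have hw2 : ‖w‖ < ‖s‖ + 1 := by simpa using hw2
    refine (norm_zetaTerm_le n (by linarith)).trans ?_
    have : ‖w - 1‖ ≤ ‖s‖ + 2 := (norm_sub_le _ _).trans (by rw [norm_one]; linarith)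
    gcongr
    simp
  have hd2 : DifferentiableOn ℂ (fun s ↦ riemannZeta₁ s - 1) {z : ℂ | 0 < z.re} :=
    (differentiable_riemannZeta₁.sub_const 1).differentiableOn
  refine (hd.analyticOnNhd isOpen_re_pos).eqOn_of_preconnected_of_eventuallyEq
    (hd2.analyticOnNhd isOpen_re_pos) isPreconnected_re_pos (z₀ := 2) (by simp) ?_ hs
  filter_upwards [(isOpen_lt continuous_const continuous_re).mem_nhds
    (show (2 : ℂ) ∈ {z : ℂ | 1 < z.re} by simp)] with z hz
  exact tsum_zetaTerm_of_one_lt_re hz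

lemma norm_riemannZeta₁_le {s : ℂ} (hs : 0 < s.re) :
    ‖riemannZeta₁ s‖ ≤ 1 + ‖s - 1‖ * ‖s‖ * ((s.re + 1) / s.re) := by
  have h1 : ‖∑' n, zetaTerm n s‖ ≤ ‖s - 1‖ * ‖s‖ * ((s.re + 1) / s.re) := by
    refine (tsum_of_norm_bounded
      ((summable_one_div_nat_add_one_rpow (s := s.re + 1) (by linarith)).mul_left _).hasSum
      fun n ↦ norm_zetaTerm_le n hs).trans ?_
    rw [tsum_mul_left]
    gcongr
    simpa using tsum_one_div_nat_add_one_rpow_le (s := s.re + 1) (by linarith)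
  have h2 : riemannZeta₁ s = 1 + ∑' n, zetaTerm n s := by rw [tsum_zetaTerm hs]; ring
  rw [h2]
  exact (norm_add_le _ _).trans (by rw [norm_one]; linarith)

/-- `Γ(z) / Γ(z + 1/2)` is bounded by a multiple of `1 + 1 / Re z` on the right half-plane. -/
lemma exists_norm_Gamma_div_Gamma_add_half_le :
    ∃ C : ℝ, 0 ≤ C ∧ ∀ z : ℂ, 0 < z.re → ‖Gamma z / Gamma (z + 1 / 2)‖ ≤ C * ((1 + z.re) / z.re) := by
  have hhalf : (0 : ℝ) < (1 / 2 : ℂ).re := by norm_num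
  have hint := betaIntegral_convergent (u := 1) (v := 1 / 2) (by simp) hhalf
  set I : ℝ := ∫ x : ℝ in (0 : ℝ)..1, ‖(x : ℂ) ^ ((1 : ℂ) - 1) * (1 - (x : ℂ)) ^ (1 / 2 - 1 : ℂ)‖
  have hI : 0 ≤ I := intervalIntegral.integral_nonneg zero_le_one fun x _ ↦ norm_nonneg _
  have hG : Gamma (1 / 2) ≠ 0 := Gamma_ne_zero_of_re_pos hhalf
  refine ⟨I * ‖Gamma (1 / 2)‖⁻¹, by positivity, fun z hz ↦ ?_⟩
  have hz0 : z ≠ 0 := by rintro rfl; simp at hz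
  have hz2 : 0 < (z + 1 / 2).re := by rw [add_re]; positivity
  have hz2' : z + 1 / 2 ≠ 0 := fun h ↦ by rw [h] at hz2; simp at hz2
  have hB : ‖betaIntegral (z + 1) (1 / 2)‖ ≤ I := by
    refine intervalIntegral.norm_integral_le_of_norm_le zero_le_one ?_ hint.norm
    refine Filter.Eventually.of_forall fun x hx ↦ ?_
    rw [norm_mul, norm_mul, sub_self, cpow_zero, norm_one, norm_cpow_eq_rpow_re_of_pos hx.1]
    gcongr
    exact Real.rpow_le_one hx.1.le hx.2 (by simpa using hz.le)
  have hrec : Gamma z / Gamma (z + 1 / 2) =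
      betaIntegral (z + 1) (1 / 2) * (Gamma (1 / 2))⁻¹ * ((z + 1 / 2) / z) := by
    rw [betaIntegral_eq_Gamma_mul_div _ _ (by rw [add_re, one_re]; linarith) hhalf,
      show z + 1 + 1 / 2 = (z + 1 / 2) + 1 by ring, Gamma_add_one _ hz0, Gamma_add_one _ hz2']
    have := Gamma_ne_zero_of_re_pos hz2
    generalize Gamma (z + 1 / 2) = G at *
    generalize z + 1 / 2 = w at *
    field_simp
  rw [hrec, norm_mul, norm_mul, norm_inv]
  gcongr
  have : (z + 1 / 2) / z = 1 + 1 / 2 / z := by field_simp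
  rw [this]
  have h3 : ‖(1 : ℂ) / 2 / z‖ ≤ 1 / z.re := by
    rw [norm_div]
    exact div_le_div₀ zero_le_one (by norm_num) hz (re_le_norm z)
  refine (norm_add_le _ _).trans ?_
  rw [norm_one, add_div, div_self hz.ne']
  linarith

/-- A Phragmén–Lindelöf principle on the right half-plane: a function that is bounded by `1` on the
imaginary axis and by `C * (1 + ‖z‖) ^ 5 / (re z) ^ 3` inside is bounded by `1`. -/
lemma norm_le_one_of_polynomial_growth {q : ℂ → ℂ} {C : ℝ}
    (hd : ∀ z : ℂ, 0 ≤ z.re → DifferentiableAt ℂ q z)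
    (hb : ∀ z : ℂ, z.re = 0 → ‖q z‖ ≤ 1)
    (hg : ∀ z : ℂ, 0 < z.re → ‖q z‖ ≤ C * (1 + ‖z‖) ^ 5 / z.re ^ 3)
    {w : ℂ} (hw : 0 ≤ w.re) : ‖q w‖ ≤ 1 := by
  rcases hw.eq_or_lt with hw' | hw'
  · exact hb w hw'.symm
  have hC : 0 ≤ C := by
    have := (norm_nonneg _).trans (hg 1 (by simp))
    simp at this
    linarith
  have key : ∀ ε : ℝ, 0 < ε → ‖q w‖ ≤ ‖1 + ε * w‖ ^ 3 := by
    intro ε hε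
    have hone {z : ℂ} (hz : 0 ≤ z.re) : 1 ≤ ‖1 + ε * z‖ := by
      refine le_trans ?_ (re_le_norm _)
      simp
      positivity
    have hne {z : ℂ} (hz : 0 ≤ z.re) : 1 + ε * z ≠ 0 :=
      norm_pos_iff.mp (zero_lt_one.trans_le (hone hz))
    have hlarge {z : ℂ} (hz : 0 ≤ z.re) : ε * ‖z‖ ≤ ‖1 + ε * z‖ := by
      rw [← sq_le_sq₀ (by positivity) (by positivity), mul_pow, Complex.sq_norm, Complex.sq_norm,
        normSq_apply, normSq_apply]
      simp
      nlinarith [mul_nonneg hε.le hz]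
    have hR : ∀ R : ℝ, ‖w‖ < R → 1 ≤ R → C * 256 / ε ^ 3 ≤ R →
        ‖q w * (1 + w ^ 2 / R ^ 2) ^ 3 / (1 + ε * w) ^ 3‖ ≤ 1 := by
      intro R hwR hR1 hRC
      have hR0 : 0 < R := by linarith
      have hRC0 : (R : ℂ) ≠ 0 := by exact_mod_cast hR0.ne'
      set U : Set ℂ := {z | 0 < z.re} ∩ Metric.ball 0 R
      have hUo : IsOpen U := isOpen_re_pos.inter Metric.isOpen_ball
      have hUcl : closure U ⊆ {z | 0 ≤ z.re} ∩ Metric.closedBall 0 R := by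
        refine closure_minimal (fun z hz ↦ ⟨?_, Metric.ball_subset_closedBall hz.2⟩) ?_
        · exact le_of_lt (show 0 < z.re from hz.1)
        · exact (isClosed_le continuous_const continuous_re).inter Metric.isClosed_closedBall
      have hwU : w ∈ closure U :=
        subset_closure ⟨hw', by simpa using hwR⟩
      refine norm_le_of_forall_mem_frontier_norm_le
        (f := fun z ↦ q z * (1 + z ^ 2 / R ^ 2) ^ 3 / (1 + ε * z) ^ 3)
        (Metric.isBounded_ball.subset Set.inter_subset_right)
        (DifferentiableOn.diffContOnCl fun z hz ↦ DifferentiableAt.differentiableWithinAt ?_)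
        (fun z hz ↦ ?_) hwU
      · have hz0 : 0 ≤ z.re := (hUcl hz).1
        have h1 := hd z hz0
        have h2 : (1 + ε * z) ^ 3 ≠ 0 := pow_ne_zero 3 (hne hz0)
        have h3 : DifferentiableAt ℂ (fun z : ℂ ↦ (1 + ε * z) ^ 3) z := by fun_prop
        have h4 : DifferentiableAt ℂ (fun z : ℂ ↦ (1 + z ^ 2 / R ^ 2) ^ 3) z := by fun_prop
        exact (h1.mul h4).div h3 h2
      · obtain ⟨hz1, hz2⟩ := hUcl (frontier_subset_closure hz)
        have hz0 : 0 ≤ z.re := hz1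
        have hzR : ‖z‖ ≤ R := by simpa using hz2
        have hzU : z ∉ U := by
          rw [hUo.frontier_eq] at hz
          exact hz.2
        have hpos : 0 < ‖1 + ε * z‖ := norm_pos_iff.mpr (hne hz0)
        rw [norm_div, norm_mul, norm_pow, norm_pow, div_le_one (by positivity)]
        rcases hz0.eq_or_lt with hz0' | hz0'
        · have hsq : 1 + z ^ 2 / R ^ 2 = ((1 - z.im ^ 2 / R ^ 2 : ℝ) : ℂ) := by
            have : z = z.im * I := by
              apply Complex.ext <;> simp [← hz0']
            nth_rw 1 [this]
            push_cast
            rw [mul_pow, I_sq]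
            ring
          have him : z.im ^ 2 / R ^ 2 ≤ 1 := by
            rw [div_le_one (by positivity), ← sq_abs z.im]
            gcongr
            exact (abs_im_le_norm z).trans hzR
          have h1 : ‖1 + z ^ 2 / R ^ 2‖ ≤ 1 := by
            rw [hsq, norm_real, Real.norm_eq_abs, abs_of_nonneg (by linarith)]
            linarith [show 0 ≤ z.im ^ 2 / R ^ 2 by positivity]
          calc ‖q z‖ * ‖1 + z ^ 2 / R ^ 2‖ ^ 3 ≤ 1 * 1 ^ 3 := by
                gcongr
                exact hb z hz0'.symm
            _ ≤ ‖1 + ε * z‖ ^ 3 := by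
                rw [one_mul]
                gcongr
                exact hone hz0
        · have hzR' : ‖z‖ = R := by
            refine hzR.antisymm (not_lt.mp fun h ↦ hzU ⟨hz0', by simpa using h⟩)
          have hsq : ‖1 + z ^ 2 / R ^ 2‖ = 2 * z.re / R := by
            have h1 : (R : ℂ) ^ 2 = z * conj z := by
              rw [mul_conj, normSq_eq_norm_sq, hzR']
              push_cast
              rfl
            have h2 : 1 + z ^ 2 / R ^ 2 = z * (2 * z.re : ℝ) / R ^ 2 := by
              rw [← add_conj, eq_div_iff (pow_ne_zero 2 hRC0), add_mul, one_mul,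
                div_mul_cancel₀ _ (pow_ne_zero 2 hRC0), h1]
              ring
            rw [h2, norm_div, norm_mul, norm_pow, norm_real, norm_real, hzR', Real.norm_eq_abs,
              Real.norm_eq_abs, abs_of_pos hR0, abs_of_pos (by positivity)]
            field_simp
          calc ‖q z‖ * ‖1 + z ^ 2 / R ^ 2‖ ^ 3
              ≤ C * (R + R) ^ 5 / z.re ^ 3 * (2 * z.re / R) ^ 3 := by
                rw [hsq]
                gcongr
                refine (hg z hz0').trans ?_
                rw [hzR']
                gcongr
            _ = C * 256 / ε ^ 3 * (ε ^ 3 * R ^ 2) := by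
                field_simp
                ring
            _ ≤ R * (ε ^ 3 * R ^ 2) := by gcongr
            _ = (ε * ‖z‖) ^ 3 := by rw [hzR']; ring
            _ ≤ ‖1 + ε * z‖ ^ 3 := by
                gcongr
                exact hlarge hz0
    have hpos : 0 < ‖1 + ε * w‖ := norm_pos_iff.mpr (hne hw)
    have hlim : Filter.Tendsto (fun R : ℝ ↦ ‖q w * (1 + w ^ 2 / R ^ 2) ^ 3 / (1 + ε * w) ^ 3‖)
        Filter.atTop (nhds ‖q w * (1 + 0) ^ 3 / (1 + ε * w) ^ 3‖) := by
      have h0 : Filter.Tendsto (fun R : ℝ ↦ w ^ 2 / (R : ℂ) ^ 2) Filter.atTop (nhds 0) := by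
        rw [tendsto_zero_iff_norm_tendsto_zero]
        have : Filter.Tendsto (fun R : ℝ ↦ ‖w‖ ^ 2 / R ^ 2) Filter.atTop (nhds 0) :=
          (Filter.tendsto_pow_atTop two_ne_zero).const_div_atTop _
        refine this.congr fun R ↦ ?_
        simp
      exact ((((h0.const_add 1).pow 3).const_mul (q w)).div_const _).norm
    have := le_of_tendsto hlim (by
      filter_upwards [Filter.eventually_gt_atTop ‖w‖, Filter.eventually_ge_atTop 1,
        Filter.eventually_ge_atTop (C * 256 / ε ^ 3)] with R h1 h2 h3 using hR R h1 h2 h3)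
    rw [add_zero, one_pow, mul_one, norm_div, norm_pow, div_le_one (by positivity)] at this
    exact this
  have hlim : Filter.Tendsto (fun ε : ℝ ↦ ‖1 + ε * w‖ ^ 3) (nhdsWithin 0 (Set.Ioi 0)) (nhds 1) := by
    have : ContinuousAt (fun ε : ℝ ↦ ‖1 + ε * w‖ ^ 3) 0 := by fun_prop
    simpa [ContinuousAt] using this.tendsto.mono_left nhdsWithin_le_nhds
  refine ge_of_tendsto hlim ?_
  filter_upwards [self_mem_nhdsWithin] with ε hε using key ε hε

lemma norm_add_conj_sq (a b : ℂ) : ‖a + conj b‖ ^ 2 = ‖a - b‖ ^ 2 + 4 * (a.re * b.re) := by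
  rw [Complex.sq_norm, Complex.sq_norm, normSq_apply, normSq_apply]
  simp
  ring

lemma norm_sub_lt_norm_add_conj {a b : ℂ} (ha : 0 < a.re) (hb : 0 < b.re) :
    ‖a - b‖ < ‖a + conj b‖ := by
  rw [← sq_lt_sq₀ (norm_nonneg _) (norm_nonneg _), norm_add_conj_sq]
  linarith [mul_pos ha hb]

/-- The Möbius map from the unit disc to the right half-plane that sends `0` to `w`. -/
noncomputable def discToHalfPlane (w ζ : ℂ) : ℂ := (w + conj w * ζ) / (1 - ζ)

lemma one_sub_ne_zero_of_norm_lt_one {ζ : ℂ} (hζ : ‖ζ‖ < 1) : 1 - ζ ≠ 0 := by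
  rintro h
  rw [← sub_eq_zero.mp h, norm_one] at hζ
  exact lt_irrefl _ hζ

lemma discToHalfPlane_re_pos {w ζ : ℂ} (hw : 0 < w.re) (hζ : ‖ζ‖ < 1) :
    0 < (discToHalfPlane w ζ).re := by
  have h1 := one_sub_ne_zero_of_norm_lt_one hζ
  have h2 : (discToHalfPlane w ζ).re = w.re * (1 - ‖ζ‖ ^ 2) / normSq (1 - ζ) := by
    rw [discToHalfPlane, div_re, Complex.sq_norm, normSq_apply ζ]
    simp
    ring
  rw [h2]
  have h3 : 0 < normSq (1 - ζ) := normSq_pos.mpr h1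
  have h4 : ‖ζ‖ ^ 2 < 1 := by
    rw [sq_lt_one_iff₀ (norm_nonneg _)]
    exact hζ
  exact div_pos (mul_pos hw (by linarith)) h3

lemma add_conj_ne_zero {z w : ℂ} (hz : 0 < z.re) (hw : 0 < w.re) : z + conj w ≠ 0 :=
  norm_pos_iff.mp ((norm_nonneg _).trans_lt (norm_sub_lt_norm_add_conj hz hw))

lemma norm_sub_div_add_conj_lt_one {z w : ℂ} (hz : 0 < z.re) (hw : 0 < w.re) :
    ‖(z - w) / (z + conj w)‖ < 1 := by
  rw [norm_div, div_lt_one (norm_pos_iff.mpr (add_conj_ne_zero hz hw))]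
  exact norm_sub_lt_norm_add_conj hz hw

lemma discToHalfPlane_sub_div {z w : ℂ} (hz : 0 < z.re) (hw : 0 < w.re) :
    discToHalfPlane w ((z - w) / (z + conj w)) = z := by
  have h1 := add_conj_ne_zero hz hw
  have h2 := one_sub_ne_zero_of_norm_lt_one (norm_sub_div_add_conj_lt_one hz hw)
  rw [discToHalfPlane, div_eq_iff h2]
  field_simp
  ring

section HalfPlane

variable {m : ℂ → ℂ} (hm : DifferentiableOn ℂ m {z | 0 < z.re})
  (hpos : ∀ z : ℂ, 0 < z.re → 0 < (m z).re)

include hm hpos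

lemma differentiableOn_disc_conjugate {w : ℂ} (hw : 0 < w.re) :
    DifferentiableOn ℂ (fun ζ ↦ (m (discToHalfPlane w ζ) - m w) /
      (m (discToHalfPlane w ζ) + conj (m w))) (Metric.ball 0 1) := by
  intro ζ hζ
  have hζ : ‖ζ‖ < 1 := by simpa using hζ
  have h1 := one_sub_ne_zero_of_norm_lt_one hζ
  have h2 := discToHalfPlane_re_pos hw hζ
  have h3 : DifferentiableAt ℂ (discToHalfPlane w) ζ := by
    unfold discToHalfPlane
    fun_prop (disch := exact h1)
  have h4 : DifferentiableAt ℂ (fun ζ ↦ m (discToHalfPlane w ζ)) ζ :=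
    (hm.differentiableAt (isOpen_re_pos.mem_nhds h2)).comp ζ h3
  exact ((h4.sub_const _).div (h4.add_const _)
    (add_conj_ne_zero (hpos _ h2) (hpos _ hw))).differentiableWithinAt

lemma schwarz_pick_re_pos {z w : ℂ} (hz : 0 < z.re) (hw : 0 < w.re) :
    ‖m z - m w‖ ^ 2 * (z.re * w.re) ≤ ‖z - w‖ ^ 2 * ((m z).re * (m w).re) := by
  have h0 := norm_le_norm_of_mapsTo_ball (differentiableOn_disc_conjugate hm hpos hw)
    (fun ζ hζ ↦ by
      have hζ : ‖ζ‖ < 1 := by simpa using hζ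
      simpa using (norm_sub_div_add_conj_lt_one
        (hpos _ (discToHalfPlane_re_pos hw hζ)) (hpos _ hw)).le)
    (by simp [discToHalfPlane]) (norm_sub_div_add_conj_lt_one hz hw)
  rw [discToHalfPlane_sub_div hz hw, norm_div, norm_div,
    div_le_div_iff₀ (norm_pos_iff.mpr (add_conj_ne_zero (hpos _ hz) (hpos _ hw)))
      (norm_pos_iff.mpr (add_conj_ne_zero hz hw))] at h0
  have h1 := pow_le_pow_left₀ (by positivity) h0 2
  rw [mul_pow, mul_pow, norm_add_conj_sq, norm_add_conj_sq] at h1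
  linarith

/-- An analytic self-map of the right half-plane with a fixed point of multiplier `1` inside the
half-plane is the identity. -/
lemma eq_self_of_fixed_of_re_pos {p : ℂ} (hp : 0 < p.re) (hfix : m p = p)
    (hder : HasDerivAt m 1 p) {z : ℂ} (hz : 0 < z.re) : m z = z := by
  set f : ℂ → ℂ := fun ζ ↦ (m (discToHalfPlane p ζ) - m p) / (m (discToHalfPlane p ζ) + conj (m p))
    with hf
  have hpp : p + conj p ≠ 0 := add_conj_ne_zero hp hp
  have h0 : discToHalfPlane p 0 = p := by simp [discToHalfPlane]
  have hf0 : f 0 = 0 := by simp [hf, h0]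
  have hT : HasDerivAt (discToHalfPlane p) (p + conj p) 0 := by
    have h1 : HasDerivAt (fun ζ : ℂ ↦ p + conj p * ζ) (conj p) 0 := by
      simpa using ((hasDerivAt_id (0 : ℂ)).const_mul (conj p)).const_add p
    have h2 : HasDerivAt (fun ζ : ℂ ↦ 1 - ζ) (-1) 0 := by
      simpa using (hasDerivAt_id (0 : ℂ)).const_sub 1
    refine (h1.div h2 (by simp)).congr_deriv ?_
    simp
    ring
  have hmT : HasDerivAt (fun ζ ↦ m (discToHalfPlane p ζ)) (1 * (p + conj p)) 0 :=
    HasDerivAt.comp 0 (by rwa [h0]) hT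
  have hfd : HasDerivAt f 1 0 := by
    refine ((hmT.sub_const (m p)).div (hmT.add_const (conj (m p))) ?_).congr_deriv ?_
    · rwa [h0, hfix]
    · rw [h0, hfix, sub_self, zero_mul, sub_zero, one_mul, pow_two, div_self (mul_ne_zero hpp hpp)]
  have haff := affine_of_mapsTo_ball_of_norm_dslope_eq_div (f := f) (c := 0) (z₀ := 0) (R₁ := 1)
    (R₂ := 1) (differentiableOn_disc_conjugate hm hpos hp)
    (fun ζ hζ ↦ by
      have hζ : ‖ζ‖ < 1 := by simpa using hζ
      rw [hf0, mem_closedBall_zero_iff]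
      exact (norm_sub_div_add_conj_lt_one
        (hpos _ (discToHalfPlane_re_pos hp hζ)) (hpos _ hp)).le)
    (by simp) (by rw [dslope_same, hfd.deriv]; simp)
  have h3 := haff (x := (z - p) / (z + conj p))
    (by simpa using norm_sub_div_add_conj_lt_one hz hp)
  simp only [dslope_same, hfd.deriv, hf0, sub_zero, smul_eq_mul, mul_one, zero_add] at h3
  rw [hf] at h3
  simp only [discToHalfPlane_sub_div hz hp, hfix] at h3
  rw [div_eq_div_iff (by simpa only [hfix] using add_conj_ne_zero (hpos z hz) (hpos p hp))
    (add_conj_ne_zero hz hp)] at h3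
  have h4 : (m z - z) * (p + conj p) = 0 := by linear_combination h3
  exact sub_eq_zero.mp ((mul_eq_zero.mp h4).resolve_right hpp)

/-- Julia's inequality at a fixed boundary point of multiplier `1`. -/
lemma julia_of_fixed {p : ℂ} (hp : p.re = 0) (hfix : m p = p) (hder : HasDerivAt m 1 p)
    {z : ℂ} (hz : 0 < z.re) : ‖m z - p‖ ^ 2 * z.re ≤ ‖z - p‖ ^ 2 * (m z).re := by
  have hline : HasDerivAt (fun ε : ℝ ↦ p + ε) 1 0 := by
    simpa using (hasDerivAt_id (0 : ℝ)).ofReal_comp.const_add p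
  have hmd : HasDerivAt (fun ε : ℝ ↦ m (p + ε)) (1 * 1) 0 :=
    HasDerivAt.comp (h := fun ε : ℝ ↦ p + ε) 0 (by simpa using hder) hline
  have hre : HasDerivAt (fun ε : ℝ ↦ (m (p + ε)).re) 1 0 := by
    have := (reCLM.hasFDerivAt (x := m (p + (0 : ℝ)))).comp_hasDerivAt (0 : ℝ) hmd
    simpa [Function.comp_def] using this
  have hslope := (hasDerivAt_iff_tendsto_slope_zero.mp hre).mono_left
    (nhdsWithin_mono (0 : ℝ) (fun x (hx : 0 < x) ↦ hx.ne') :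
      nhdsWithin (0 : ℝ) (Set.Ioi 0) ≤ nhdsWithin 0 {0}ᶜ)
  have hcm : Filter.Tendsto (fun ε : ℝ ↦ m (p + ε)) (nhdsWithin 0 (Set.Ioi 0)) (nhds p) := by
    have := hmd.continuousAt.tendsto.mono_left
      (nhdsWithin_le_nhds (a := (0 : ℝ)) (s := Set.Ioi 0))
    simpa [hfix] using this
  have hcl : Filter.Tendsto (fun ε : ℝ ↦ p + (ε : ℂ)) (nhdsWithin 0 (Set.Ioi 0)) (nhds p) := by
    have := hline.continuousAt.tendsto.mono_left
      (nhdsWithin_le_nhds (a := (0 : ℝ)) (s := Set.Ioi 0))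
    simpa using this
  have hL := ((hcm.const_sub (m z)).norm.pow 2).mul_const z.re
  have hR := ((hcl.const_sub z).norm.pow 2).mul (hslope.const_mul (m z).re)
  rw [mul_one] at hR
  refine le_of_tendsto_of_tendsto hL hR ?_
  filter_upwards [self_mem_nhdsWithin] with ε hε
  have hε : 0 < ε := hε
  have hw : (p + (ε : ℂ)).re = ε := by simp [hp]
  have := schwarz_pick_re_pos hm hpos hz (w := p + ε) (by rwa [hw])
  rw [hw] at this
  simp only [zero_add, ofReal_zero, add_zero, hfix, hp, sub_zero, smul_eq_mul]
  refine le_of_mul_le_mul_right ?_ hε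
  calc _ = ‖m z - m (p + ε)‖ ^ 2 * (z.re * ε) := by ring
    _ ≤ _ := this
    _ = _ := by field_simp

/-- An analytic self-map of the right half-plane which is real on the positive reals and has a
nonzero fixed point of multiplier `1` on the imaginary axis is the identity. -/
lemma eq_self_of_fixed_of_re_eq_zero (hreal : ∀ x : ℝ, 0 < x → (m x).im = 0) {p : ℂ}
    (hp : p.re = 0) (hp0 : p ≠ 0) (hfix : m p = p) (hder : HasDerivAt m 1 p) {z : ℂ}
    (hz : 0 < z.re) : m z = z := by
  have hJ {z : ℂ} (hz : 0 < z.re) := julia_of_fixed hm hpos hp hfix hder hz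
  have hne {z : ℂ} (hz : 0 < z.re) : z - p ≠ 0 := fun h ↦ by
    rw [sub_eq_zero.mp h, hp] at hz
    exact lt_irrefl _ hz
  set t : ℝ := |p.im| with ht
  have hpim : p.im ≠ 0 := fun h ↦ hp0 (Complex.ext hp h)
  have htpos : 0 < t := abs_pos.mpr hpim
  have htre : 0 < (t : ℂ).re := by simpa using htpos
  have hmt : m t = t := by
    have h := hJ htre
    have hy := hpos t htre
    rw [Complex.sq_norm, Complex.sq_norm, normSq_apply, normSq_apply] at h
    simp only [sub_re, sub_im, hp, hreal t htpos, ofReal_re, ofReal_im, sub_zero, zero_sub,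
      neg_mul_neg] at h
    have hsq : p.im * p.im = t * t := (abs_mul_abs_self _).symm
    rw [hsq] at h
    have h2 : t * ((m t).re - t) ^ 2 ≤ 0 := by linarith
    have h3 : ((m t).re - t) ^ 2 = 0 :=
      le_antisymm (nonpos_of_mul_nonpos_right h2 htpos) (sq_nonneg _)
    refine Complex.ext ?_ (by simpa using hreal t htpos)
    simpa [sub_eq_zero] using h3
  set H : ℂ → ℂ := fun z ↦ 1 + ((m z - p)⁻¹ - (z - p)⁻¹) with hH
  have hHre {z : ℂ} (hz : 0 < z.re) : 1 ≤ (H z).re := by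
    have h1 := hJ hz
    have h2 : 0 < ‖m z - p‖ ^ 2 := by
      have := norm_pos_iff.mpr (hne (hpos z hz))
      positivity
    have h3 : 0 < ‖z - p‖ ^ 2 := by
      have := norm_pos_iff.mpr (hne hz)
      positivity
    simp only [hH, add_re, sub_re, inv_re, one_re, hp, sub_zero, normSq_eq_norm_sq]
    have : z.re / ‖z - p‖ ^ 2 ≤ (m z).re / ‖m z - p‖ ^ 2 := by
      rw [div_le_div_iff₀ h3 h2]
      linarith
    linarith
  have hHnorm {z : ℂ} (hz : 0 < z.re) : 1 ≤ ‖H z‖ := (hHre hz).trans (re_le_norm _)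
  have hHd : DifferentiableOn ℂ (fun z ↦ (H z)⁻¹) {z | 0 < z.re} := by
    intro z hz
    have hz : 0 < z.re := hz
    have hmz := hm.differentiableAt (isOpen_re_pos.mem_nhds hz)
    refine (DifferentiableAt.inv ?_ (norm_pos_iff.mp
      (zero_lt_one.trans_le (hHnorm hz)))).differentiableWithinAt
    exact (((hmz.sub_const p).inv (hne (hpos z hz))).sub
      ((differentiableAt_id.sub_const p).inv (hne hz))).const_add 1
  have hHt : H t = 1 := by simp [hH, hmt]
  have hconst := eqOn_of_isPreconnected_of_isMaxOn_norm isPreconnected_re_pos isOpen_re_pos hHd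
    htre (fun w hw ↦ by
      have hw : 0 < w.re := hw
      show ‖(H w)⁻¹‖ ≤ ‖(H t)⁻¹‖
      rw [hHt, norm_inv, inv_one, norm_one]
      exact inv_le_one_of_one_le₀ (hHnorm hw)) hz
  simp only [Function.const, hHt, inv_one, inv_eq_one] at hconst
  have h1 : (m z - p)⁻¹ = (z - p)⁻¹ := by
    simp only [hH] at hconst
    linear_combination hconst
  simpa using inv_injective h1

end HalfPlane

/-- The entire function `s * (s - 1) * Λ(s)`, where `Λ` is the completed zeta function. -/
noncomputable def entireXi (s : ℂ) : ℂ := s * (s - 1) * completedRiemannZeta₀ s + 1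

lemma differentiable_entireXi : Differentiable ℂ entireXi := by
  have := differentiable_completedZeta₀
  unfold entireXi
  fun_prop

lemma entireXi_eq {s : ℂ} (h0 : s ≠ 0) (h1 : s ≠ 1) :
    entireXi s = s * (s - 1) * completedRiemannZeta s := by
  have h2 : 1 - s ≠ 0 := sub_ne_zero.mpr h1.symm
  rw [completedRiemannZeta_eq, entireXi]
  field_simp
  ring

lemma entireXi_one_sub (s : ℂ) : entireXi (1 - s) = entireXi s := by
  rw [entireXi, entireXi, completedRiemannZeta₀_one_sub]
  ring

lemma entireXi_one : entireXi 1 = 1 := by simp [entireXi]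

lemma entireXi_eq_mul_riemannZeta₁ {s : ℂ} (hs : 0 < s.re) :
    entireXi s = s * Gammaℝ s * riemannZeta₁ s := by
  rcases eq_or_ne s 1 with rfl | h1
  · simp [entireXi_one]
  have h0 : s ≠ 0 := by rintro rfl; simp at hs
  have hG := Gammaℝ_ne_zero_of_re_pos hs
  have h2 := sub_ne_zero.mpr h1
  have h3 := riemannZeta_eq_inv_sub_mul h1
  rw [riemannZeta_def_of_ne_zero h0] at h3
  rw [entireXi_eq h0 h1]
  field_simp at h3
  linear_combination s * h3

lemma entireXi_eq_mul_riemannZeta {s : ℂ} (hs : 0 < s.re) (h1 : s ≠ 1) :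
    entireXi s = s * (s - 1) * Gammaℝ s * riemannZeta s := by
  rw [entireXi_eq_mul_riemannZeta₁ hs, riemannZeta_eq_inv_sub_mul h1]
  field_simp [sub_ne_zero.mpr h1]

lemma entireXi_ne_zero {s : ℂ} (hs : 1 ≤ s.re) : entireXi s ≠ 0 := by
  rcases eq_or_ne s 1 with rfl | h1
  · simp [entireXi_one]
  have hs' : 0 < s.re := by linarith
  have h0 : s ≠ 0 := by rintro rfl; simp at hs'
  rw [entireXi_eq_mul_riemannZeta hs' h1]
  exact mul_ne_zero (mul_ne_zero (mul_ne_zero h0 (sub_ne_zero.mpr h1))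
    (Gammaℝ_ne_zero_of_re_pos hs')) (riemannZeta_ne_zero_of_one_le_re hs)

lemma Gammaℝ_conj (s : ℂ) : Gammaℝ (conj s) = conj (Gammaℝ s) := by
  have h : (Real.pi : ℂ).arg ≠ Real.pi := by
    rw [arg_ofReal_of_nonneg Real.pi_pos.le]
    exact Real.pi_pos.ne
  have h2 : conj s / 2 = conj (s / 2) := by rw [map_div₀, map_ofNat]
  have h3 : -conj s / 2 = conj (-s / 2) := by rw [map_div₀, map_neg, map_ofNat]
  rw [Gammaℝ_def, Gammaℝ_def, map_mul, h2, h3, Gamma_conj, cpow_conj _ _ h, conj_ofReal]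

lemma entireXi_conj {s : ℂ} (hs : 0 < s.re) : entireXi (conj s) = conj (entireXi s) := by
  rcases eq_or_ne s 1 with rfl | h1
  · simp [entireXi_one]
  have h2 : conj s ≠ 1 := fun h ↦ h1 (by simpa using congrArg conj h)
  rw [entireXi_eq_mul_riemannZeta hs h1, entireXi_eq_mul_riemannZeta (by simpa) h2,
    Gammaℝ_conj, riemannZeta_conj]
  simp

lemma entireXi_two : entireXi 2 = Real.pi / 3 := by
  have : (Real.pi : ℂ) ≠ 0 := mod_cast Real.pi_ne_zero
  rw [entireXi_eq_mul_riemannZeta (by simp) (by norm_num), Gammaℝ_def, riemannZeta_two]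
  norm_num
  rw [cpow_neg_one]
  field_simp
  norm_num

/-- The scattering quotient `ξ(z) / ξ(1 + z)`. -/
noncomputable def xiQuotient (z : ℂ) : ℂ := entireXi z / entireXi (1 + z)

lemma entireXi_one_add_ne_zero {z : ℂ} (hz : 0 ≤ z.re) : entireXi (1 + z) ≠ 0 :=
  entireXi_ne_zero (by simpa)

lemma differentiableAt_xiQuotient {z : ℂ} (hz : 0 ≤ z.re) : DifferentiableAt ℂ xiQuotient z := by
  have h1 := differentiable_entireXi
  have h2 : Differentiable ℂ fun z ↦ entireXi (1 + z) := by fun_prop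
  exact (h1 z).div (h2 z) (entireXi_one_add_ne_zero hz)

lemma norm_xiQuotient_eq_one {z : ℂ} (hz : z.re = 0) : ‖xiQuotient z‖ = 1 := by
  have h1 : entireXi z = conj (entireXi (1 + z)) := by
    rw [← entireXi_conj (by simp [hz]), ← entireXi_one_sub]
    congr 1
    apply Complex.ext <;> simp [hz]
  have h2 := norm_ne_zero_iff.mpr (entireXi_one_add_ne_zero hz.ge)
  rw [xiQuotient, h1, norm_div, norm_conj, div_self h2]

lemma Gammaℝ_div_Gammaℝ_one_add (z : ℂ) :
    Gammaℝ z / Gammaℝ (1 + z) =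
      (Real.pi : ℂ) ^ (1 / 2 : ℂ) * (Gamma (z / 2) / Gamma (z / 2 + 1 / 2)) := by
  have hpi : (Real.pi : ℂ) ≠ 0 := mod_cast Real.pi_ne_zero
  have h1 : -z / 2 = 1 / 2 + -(1 + z) / 2 := by ring
  have h2 : (1 + z) / 2 = z / 2 + 1 / 2 := by ring
  have h3 : (Real.pi : ℂ) ^ (-(1 + z) / 2) ≠ 0 := by simp [cpow_eq_zero_iff, hpi]
  rw [Gammaℝ_def, Gammaℝ_def, h1, cpow_add _ _ hpi, h2]
  field_simp

lemma xiQuotient_eq {z : ℂ} (hz : 0 < z.re) :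
    xiQuotient z = riemannZeta₁ z * (riemannZeta (1 + z))⁻¹ * (1 + z)⁻¹ *
      ((Real.pi : ℂ) ^ (1 / 2 : ℂ) * (Gamma (z / 2) / Gamma (z / 2 + 1 / 2))) := by
  have h0 : z ≠ 0 := by rintro rfl; simp at hz
  rw [← Gammaℝ_div_Gammaℝ_one_add, xiQuotient, entireXi_eq_mul_riemannZeta₁ hz,
    entireXi_eq_mul_riemannZeta (by simp; linarith) (by simpa), add_sub_cancel_left]
  field_simp

lemma exists_norm_xiQuotient_le : ∃ C : ℝ, ∀ z : ℂ, 0 < z.re →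
    ‖xiQuotient z‖ ≤ C * (1 + ‖z‖) ^ 5 / z.re ^ 3 := by
  obtain ⟨C, hC, h⟩ := exists_norm_Gamma_div_Gamma_add_half_le
  refine ⟨‖(Real.pi : ℂ) ^ (1 / 2 : ℂ)‖ * (2 * C), fun z hz ↦ ?_⟩
  set K := ‖(Real.pi : ℂ) ^ (1 / 2 : ℂ)‖
  have hK : 0 ≤ K := norm_nonneg _
  have hxr : z.re ≤ ‖z‖ := re_le_norm z
  have hr := norm_nonneg z
  have h1 : ‖riemannZeta₁ z‖ ≤ (1 + ‖z‖) ^ 3 / z.re := by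
    refine (norm_riemannZeta₁_le hz).trans ?_
    have h2 : ‖z - 1‖ ≤ ‖z‖ + 1 := by simpa using norm_sub_le z 1
    calc 1 + ‖z - 1‖ * ‖z‖ * ((z.re + 1) / z.re)
        ≤ 1 + (‖z‖ + 1) * ‖z‖ * ((‖z‖ + 1) / z.re) := by gcongr
      _ = (z.re + (‖z‖ + 1) ^ 2 * ‖z‖) / z.re := by field_simp
      _ ≤ (1 + ‖z‖) ^ 3 / z.re := by
        gcongr
        nlinarith
  have h2 : ‖(riemannZeta (1 + z))⁻¹‖ ≤ (1 + ‖z‖) / z.re := by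
    refine (norm_inv_riemannZeta_le (by simpa)).trans ?_
    simp only [add_re, one_re, add_sub_cancel_left]
    gcongr
  have h3 : ‖(1 + z)⁻¹‖ ≤ 1 := by
    rw [norm_inv]
    refine inv_le_one_of_one_le₀ (le_trans ?_ (re_le_norm _))
    simp [hz.le]
  have h4 : ‖Gamma (z / 2) / Gamma (z / 2 + 1 / 2)‖ ≤ 2 * C * ((1 + ‖z‖) / z.re) := by
    have h5 : (z / 2).re = z.re / 2 := by simp
    refine (h (z / 2) (by rw [h5]; positivity)).trans ?_
    rw [h5]
    calc C * ((1 + z.re / 2) / (z.re / 2)) = 2 * C * ((1 + z.re / 2) / z.re) := by field_simp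
      _ ≤ 2 * C * ((1 + ‖z‖) / z.re) := by
        gcongr
        linarith
  rw [xiQuotient_eq hz, norm_mul, norm_mul, norm_mul, norm_mul]
  calc _ ≤ (1 + ‖z‖) ^ 3 / z.re * ((1 + ‖z‖) / z.re) * 1 *
        (K * (2 * C * ((1 + ‖z‖) / z.re))) := by gcongr
    _ = _ := by field_simp

lemma norm_xiQuotient_le_one {z : ℂ} (hz : 0 ≤ z.re) : ‖xiQuotient z‖ ≤ 1 := by
  obtain ⟨C, hC⟩ := exists_norm_xiQuotient_le
  exact norm_le_one_of_polynomial_growth (fun _ ↦ differentiableAt_xiQuotient)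
    (fun _ h ↦ (norm_xiQuotient_eq_one h).le) hC hz

/-- The function `a ^ (-z) ξ(z) / ξ(1 + z)`. -/
noncomputable def twistedQuotient (a : ℝ) (z : ℂ) : ℂ := (a : ℂ) ^ (-z) * xiQuotient z

section twistedQuotient

variable {a : ℝ}

lemma differentiableAt_twistedQuotient (ha : 1 ≤ a) {z : ℂ} (hz : 0 ≤ z.re) :
    DifferentiableAt ℂ (twistedQuotient a) z := by
  have h0 : (a : ℂ) ≠ 0 := mod_cast (zero_lt_one.trans_le ha).ne'
  have h1 : DifferentiableAt ℂ (fun z : ℂ ↦ (a : ℂ) ^ (-z)) z :=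
    differentiableAt_id.neg.const_cpow (Or.inl h0)
  exact h1.mul (differentiableAt_xiQuotient hz)

lemma norm_twistedQuotient_le_one (ha : 1 ≤ a) {z : ℂ} (hz : 0 ≤ z.re) :
    ‖twistedQuotient a z‖ ≤ 1 := by
  rw [twistedQuotient, norm_mul, norm_cpow_eq_rpow_re_of_pos (zero_lt_one.trans_le ha)]
  exact mul_le_one₀ (Real.rpow_le_one_of_one_le_of_nonpos ha (by simpa)) (norm_nonneg _)
    (norm_xiQuotient_le_one hz)

lemma twistedQuotient_one (a : ℝ) : twistedQuotient a 1 = (a : ℂ)⁻¹ * (3 / Real.pi) := by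
  rw [twistedQuotient, xiQuotient, entireXi_one, one_add_one_eq_two, entireXi_two, cpow_neg_one]
  simp

lemma twistedQuotient_one_ne_zero (ha : 1 ≤ a) : twistedQuotient a 1 ≠ 0 := by
  have h0 : (a : ℂ) ≠ 0 := mod_cast (zero_lt_one.trans_le ha).ne'
  rw [twistedQuotient_one]
  simp [h0, Real.pi_ne_zero]

lemma norm_twistedQuotient_one_lt_one (ha : 1 ≤ a) : ‖twistedQuotient a 1‖ < 1 := by
  have h1 : ‖(a : ℂ)⁻¹‖ ≤ 1 := by
    rw [norm_inv, norm_real, Real.norm_of_nonneg (by linarith)]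
    exact inv_le_one_of_one_le₀ ha
  have h2 : ‖(3 / Real.pi : ℂ)‖ < 1 := by
    rw [norm_div, norm_real, Real.norm_of_nonneg Real.pi_pos.le, div_lt_one Real.pi_pos]
    simpa using Real.pi_gt_three
  rw [twistedQuotient_one, norm_mul]
  exact mul_lt_one_of_nonneg_of_lt_one_right h1 (norm_nonneg _) h2

lemma norm_twistedQuotient_lt_one (ha : 1 ≤ a) {z : ℂ} (hz : 0 < z.re) :
    ‖twistedQuotient a z‖ < 1 := by
  refine (norm_twistedQuotient_le_one ha hz.le).lt_of_ne fun h ↦ ?_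
  have h1 := norm_eqOn_of_isPreconnected_of_isMaxOn isPreconnected_re_pos isOpen_re_pos
    (fun w (hw : 0 < w.re) ↦
      (differentiableAt_twistedQuotient ha hw.le).differentiableWithinAt) hz
    (fun w (hw : 0 < w.re) ↦ by
      simpa [h] using norm_twistedQuotient_le_one ha hw.le)
  have h2 := h1 (show (1 : ℂ) ∈ {z : ℂ | 0 < z.re} by simp)
  simp only [Function.comp_apply, Function.const_apply, h] at h2
  exact (norm_twistedQuotient_one_lt_one ha).ne h2

lemma conj_twistedQuotient_ofReal (ha : 1 ≤ a) {x : ℝ} (hx : 0 < x) :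
    conj (twistedQuotient a x) = twistedQuotient a x := by
  have h1 : (a : ℂ) ^ (-x : ℂ) = ((a ^ (-x) : ℝ) : ℂ) := by
    rw [ofReal_cpow (by linarith)]
    simp
  have h2 : conj (entireXi x) = entireXi x := by
    rw [← entireXi_conj (by simpa), conj_ofReal]
  have h3 : conj (entireXi (1 + x)) = entireXi (1 + x) := by
    rw [← entireXi_conj (by simp; linarith), map_add, map_one, conj_ofReal]
  rw [twistedQuotient, xiQuotient, map_mul, map_div₀, h2, h3, h1, conj_ofReal]

/-- The Cayley transform `(1 - Q) / (1 + Q)` of `twistedQuotient`. -/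
noncomputable def cayleyQuotient (a : ℝ) (z : ℂ) : ℂ :=
  (1 - twistedQuotient a z) / (1 + twistedQuotient a z)

lemma one_add_twistedQuotient_ne_zero (ha : 1 ≤ a) {z : ℂ} (hz : 0 < z.re) :
    1 + twistedQuotient a z ≠ 0 := by
  intro h
  have h1 := norm_twistedQuotient_lt_one ha hz
  rw [show twistedQuotient a z = -1 by linear_combination h] at h1
  simp at h1

lemma differentiableOn_cayleyQuotient (ha : 1 ≤ a) :
    DifferentiableOn ℂ (cayleyQuotient a) {z | 0 < z.re} := fun z (hz : 0 < z.re) ↦ by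
  have h := differentiableAt_twistedQuotient ha hz.le
  exact ((h.const_sub 1).div (h.const_add 1)
    (one_add_twistedQuotient_ne_zero ha hz)).differentiableWithinAt

lemma re_one_sub_div_one_add_pos {w : ℂ} (hw : ‖w‖ < 1) : 0 < ((1 - w) / (1 + w)).re := by
  have h0 : 1 + w ≠ 0 := by
    intro h
    rw [show w = -1 by linear_combination h] at hw
    simp at hw
  have h1 : 0 < normSq (1 + w) := normSq_pos.mpr h0
  have h2 : ‖w‖ ^ 2 < 1 := by
    rw [sq_lt_one_iff₀ (norm_nonneg _)]
    exact hw
  rw [Complex.sq_norm, normSq_apply] at h2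
  rw [div_re, ← add_div]
  refine div_pos ?_ h1
  simp
  nlinarith

lemma cayleyQuotient_re_pos (ha : 1 ≤ a) {z : ℂ} (hz : 0 < z.re) : 0 < (cayleyQuotient a z).re :=
  re_one_sub_div_one_add_pos (norm_twistedQuotient_lt_one ha hz)

lemma cayleyQuotient_ofReal_im (ha : 1 ≤ a) {x : ℝ} (hx : 0 < x) :
    (cayleyQuotient a x).im = 0 := by
  rw [← conj_eq_iff_im, cayleyQuotient, map_div₀, map_sub, map_add, map_one,
    conj_twistedQuotient_ofReal ha hx]

lemma cayleyQuotient_one_ne_one (ha : 1 ≤ a) : cayleyQuotient a 1 ≠ 1 := by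
  intro h
  rw [cayleyQuotient, div_eq_one_iff_eq (one_add_twistedQuotient_ne_zero ha (by simp))] at h
  exact twistedQuotient_one_ne_zero ha (by linear_combination -h / 2)

/-- The function `(z - 1) + (z + 1) Q(z)` has only simple zeros in the closed right half-plane,
apart from the origin. -/
lemma not_hasDerivAt_zero_of_re_nonneg (ha : 1 ≤ a) {p : ℂ} (hp : 0 ≤ p.re) (hp0 : p ≠ 0)
    (hzero : (p - 1) + (p + 1) * twistedQuotient a p = 0) :
    ¬ HasDerivAt (fun z ↦ (z - 1) + (z + 1) * twistedQuotient a z) 0 p := by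
  intro hder
  have hQ := (differentiableAt_twistedQuotient ha hp).hasDerivAt
  set Q' := deriv (twistedQuotient a) p
  have h1 : 1 + (1 * twistedQuotient a p + (p + 1) * Q') = 0 :=
    ((((hasDerivAt_id p).sub_const 1).add (((hasDerivAt_id p).add_const 1).mul hQ)).unique hder)
  have h2 : p + 1 ≠ 0 := by
    intro h
    have := congrArg re h
    simp at this
    linarith
  have h3 : (p + 1) * (1 + twistedQuotient a p) = 2 := by linear_combination hzero
  have h4 : 1 + twistedQuotient a p ≠ 0 := by
    intro h
    simp [h] at h3
  have hfix : cayleyQuotient a p = p := by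
    rw [cayleyQuotient, div_eq_iff h4]
    linear_combination -hzero
  have hmder : HasDerivAt (cayleyQuotient a) 1 p := by
    refine ((hQ.const_sub 1).div (hQ.const_add 1) h4).congr_deriv ?_
    rw [div_eq_one_iff_eq (pow_ne_zero 2 h4)]
    linear_combination -(1 + twistedQuotient a p) * h1 + Q' * h3
  refine cayleyQuotient_one_ne_one ha ?_
  rcases hp.eq_or_lt with h | h
  · exact eq_self_of_fixed_of_re_eq_zero (differentiableOn_cayleyQuotient ha)
      (fun _ ↦ cayleyQuotient_re_pos ha) (fun _ ↦ cayleyQuotient_ofReal_im ha) h.symm hp0 hfix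
      hmder (by simp)
  · exact eq_self_of_fixed_of_re_pos (differentiableOn_cayleyQuotient ha)
      (fun _ ↦ cayleyQuotient_re_pos ha) h hfix hmder (by simp)

end twistedQuotient

lemma phi0_one_sub (a : ℝ) (s : ℂ) : phi0 a (1 - s) = phi0 a s := by
  have h1 : completedRiemannZeta (2 * (1 - s)) = completedRiemannZeta (2 * s - 1) := by
    rw [← completedRiemannZeta_one_sub]
    congr 1
    ring
  have h2 : completedRiemannZeta (2 * (1 - s) - 1) = completedRiemannZeta (2 * s) := by
    rw [← completedRiemannZeta_one_sub]
    congr 1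
    ring
  rw [phi0, phi0, h1, h2, sub_sub_cancel]
  ring

lemma differentiableAt_phi0 {a : ℝ} (ha : 1 ≤ a) {s : ℂ} (h0 : s ≠ 0) (h1 : s ≠ 1 / 2)
    (h2 : s ≠ 1) : DifferentiableAt ℂ (phi0 a) s := by
  have ha0 : (a : ℂ) ≠ 0 := mod_cast (zero_lt_one.trans_le ha).ne'
  have hd1 : DifferentiableAt ℂ (fun s ↦ completedRiemannZeta (2 * s)) s :=
    DifferentiableAt.comp s (differentiableAt_completedZeta (by simpa)
      fun h ↦ h1 (by linear_combination h / 2)) (by fun_prop)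
  have hd2 : DifferentiableAt ℂ (fun s ↦ completedRiemannZeta (2 * s - 1)) s :=
    DifferentiableAt.comp s (differentiableAt_completedZeta
      (fun h ↦ h1 (by linear_combination h / 2))
      fun h ↦ h2 (by linear_combination h / 2)) (by fun_prop)
  have hd3 : DifferentiableAt ℂ (fun s ↦ (a : ℂ) ^ s) s :=
    differentiableAt_id.const_cpow (Or.inl ha0)
  have hd4 : DifferentiableAt ℂ (fun s ↦ (a : ℂ) ^ (1 - s)) s :=
    (differentiableAt_id.const_sub 1).const_cpow (Or.inl ha0)
  exact (hd1.mul hd3).add (hd2.mul hd4)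

lemma phi0_eq {a : ℝ} (ha : 1 ≤ a) {s : ℂ} (h0 : s ≠ 0) (h1 : s ≠ 1 / 2) (h2 : s ≠ 1)
    (hne : entireXi (2 * s) ≠ 0) :
    phi0 a s * ((2 * s) * (2 * s - 1) * (2 * s - 2)) = entireXi (2 * s) * (a : ℂ) ^ s *
      (((2 * s - 1) - 1) + ((2 * s - 1) + 1) * twistedQuotient a (2 * s - 1)) := by
  have ha0 : (a : ℂ) ≠ 0 := mod_cast (zero_lt_one.trans_le ha).ne'
  have h3 : 2 * s - 1 ≠ 0 := fun h ↦ h1 (by linear_combination h / 2)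
  have h4 : 2 * s - 1 ≠ 1 := fun h ↦ h2 (by linear_combination h / 2)
  have hpow : (a : ℂ) ^ (1 - s) = (a : ℂ) ^ s * (a : ℂ) ^ (-(2 * s - 1)) := by
    rw [← cpow_add _ _ ha0]
    congr 1
    ring
  have hq : entireXi (2 * s) * xiQuotient (2 * s - 1) = entireXi (2 * s - 1) := by
    rw [xiQuotient, add_sub_cancel]
    field_simp
  have e1 := entireXi_eq (by simpa : 2 * s ≠ 0) (sub_ne_zero.mp h3)
  have e2 := entireXi_eq h3 h4
  rw [phi0, twistedQuotient, hpow]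
  rw [e2] at hq
  linear_combination (-(2 * s - 2) * (a : ℂ) ^ s) * e1 -
    2 * s * (a : ℂ) ^ s * (a : ℂ) ^ (-(2 * s - 1)) * hq

lemma deriv_phi0_ne_zero_of_re_ge {a : ℝ} (ha : 1 ≤ a) {s : ℂ} (hs : 1 / 2 ≤ s.re)
    (h1 : s ≠ 1 / 2) (h2 : s ≠ 1) (hzero : phi0 a s = 0) : deriv (phi0 a) s ≠ 0 := by
  intro hder
  have ha0 : (a : ℂ) ≠ 0 := mod_cast (zero_lt_one.trans_le ha).ne'
  have h0 : s ≠ 0 := by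
    rintro rfl
    norm_num at hs
  have hre : 0 ≤ (2 * s - 1).re := by
    simp
    linarith
  have hp0 : 2 * s - 1 ≠ 0 := fun h ↦ h1 (by linear_combination h / 2)
  have hxi : entireXi (2 * s) ≠ 0 := entireXi_ne_zero (by simp; linarith)
  have hH : entireXi (2 * s) * (a : ℂ) ^ s ≠ 0 :=
    mul_ne_zero hxi (by simp [cpow_eq_zero_iff, ha0])
  have hxid := differentiable_entireXi
  have hHd : DifferentiableAt ℂ (fun w ↦ entireXi (2 * w) * (a : ℂ) ^ w) s :=
    DifferentiableAt.mul (by fun_prop) (differentiableAt_id.const_cpow (Or.inl ha0))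
  have hgd : DifferentiableAt ℂ (fun z ↦ (z - 1) + (z + 1) * twistedQuotient a z) (2 * s - 1) := by
    have := differentiableAt_twistedQuotient ha hre
    fun_prop
  have hlin : HasDerivAt (fun w : ℂ ↦ 2 * w - 1) 2 s := by
    simpa using ((hasDerivAt_id s).const_mul 2).sub_const 1
  have hphi : HasDerivAt (phi0 a) 0 s := hder ▸ (differentiableAt_phi0 ha h0 h1 h2).hasDerivAt
  have hpoly : DifferentiableAt ℂ (fun w : ℂ ↦ (2 * w) * (2 * w - 1) * (2 * w - 2)) s := by
    fun_prop
  have hev : ∀ᶠ w in nhds s, phi0 a w * ((2 * w) * (2 * w - 1) * (2 * w - 2)) =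
      entireXi (2 * w) * (a : ℂ) ^ w *
        (((2 * w - 1) - 1) + ((2 * w - 1) + 1) * twistedQuotient a (2 * w - 1)) := by
    have hc : ContinuousAt (fun w ↦ entireXi (2 * w)) s := by
      have := hxid.continuous
      fun_prop
    filter_upwards [isOpen_ne.mem_nhds h0, isOpen_ne.mem_nhds h1, isOpen_ne.mem_nhds h2,
      hc.eventually_ne hxi] with w w0 w1 w2 w3 using phi0_eq ha w0 w1 w2 w3
  have hg0 := hev.self_of_nhds
  rw [hzero, zero_mul, eq_comm, mul_eq_zero, or_iff_right hH] at hg0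
  have hd1 := hphi.mul hpoly.hasDerivAt
  have hd2 := hHd.hasDerivAt.mul (HasDerivAt.comp s hgd.hasDerivAt hlin)
  have hd := (hd1.congr_of_eventuallyEq (Filter.EventuallyEq.symm hev)).unique hd2
  simp only [Function.comp_apply, hzero, hg0, zero_mul, mul_zero, zero_add] at hd
  have hg1 := ((mul_eq_zero.mp hd.symm).resolve_left hH)
  refine not_hasDerivAt_zero_of_re_nonneg ha hre hp0 hg0 ?_
  have hg2 := hgd.hasDerivAt
  rwa [(mul_eq_zero.mp hg1).resolve_right two_ne_zero] at hg2

/-- For every `a ≥ 1`, every zero of `φ₀(a,·)` away from `0, 1/2, 1` is simple. -/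
theorem phi0_zeros_simple (a : ℝ) (ha : 1 ≤ a) (ρ : ℂ)
    (hρ : ρ ∉ ({0, 1 / 2, 1} : Set ℂ)) (hzero : phi0 a ρ = 0) :
    deriv (phi0 a) ρ ≠ 0 := by
  simp only [Set.mem_insert_iff, Set.mem_singleton_iff, not_or] at hρ
  obtain ⟨h0, h1, h2⟩ := hρ
  rcases le_total (1 / 2) ρ.re with h | h
  · exact deriv_phi0_ne_zero_of_re_ge ha h h1 h2 hzero
  have hsymm : (fun s ↦ phi0 a (1 - s)) = phi0 a := funext (phi0_one_sub a)
  rw [← hsymm, deriv_comp_const_sub, neg_ne_zero]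
  refine deriv_phi0_ne_zero_of_re_ge ha ?_ (fun h' ↦ h1 (by linear_combination -h'))
    (fun h' ↦ h0 (by linear_combination -h')) (by rwa [phi0_one_sub])
  simp only [sub_re, one_re]
  linarith
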